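/- For n ∈ ℕ, the Horadam hybrid quaternion satisfies the Binet formula Ĥ_n = A·α*·α̲·αⁿ + B·β*·β̲·βⁿ, where α, β are the roots of x² - px + q = 0 (assumed distinct and real), A = (w_1 - w_0 β)/(α - β), B = (w_0 α - w_1)/(α - β), α* = 1 + i·α + ε·α² + h·α³, β* = 1 + i·β + ε·β² + h·β³, α̲ = 1 + i·α + j·α² + k·α³, β̲ = 1 + i·β + j·β² + k·β³. -/

import Mathlib

/-- A hybrid number over a ring `R`: `re + imI·𝐢 + imE·ε + imH·𝐡` with
`𝐢² = -1`, `ε² = 0`, `𝐡² = 1`, `𝐢ε = 1 - 𝐡`, `ε𝐢 = 1 + 𝐡`,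
`𝐢𝐡 = ε + 𝐢`, `𝐡𝐢 = -ε - 𝐢`, `ε𝐡 = -ε`, `𝐡ε = ε`. -/
@[ext]
structure Hybrid (R : Type*) where
  re : R
  imI : R
  imE : R
  imH : R

namespace Hybrid

variable {R : Type*} [Ring R]

instance : Zero (Hybrid R) := ⟨⟨0, 0, 0, 0⟩⟩
instance : One (Hybrid R) := ⟨⟨1, 0, 0, 0⟩⟩
instance : Add (Hybrid R) :=
  ⟨fun x y => ⟨x.re + y.re, x.imI + y.imI, x.imE + y.imE, x.imH + y.imH⟩⟩
instance : Neg (Hybrid R) := ⟨fun x => ⟨-x.re, -x.imI, -x.imE, -x.imH⟩⟩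
instance : Sub (Hybrid R) :=
  ⟨fun x y => ⟨x.re - y.re, x.imI - y.imI, x.imE - y.imE, x.imH - y.imH⟩⟩

/-- Multiplication of hybrid numbers, obtained by bilinear extension of the
multiplication table of the hybrid units (units commute with coefficients). -/
instance : Mul (Hybrid R) := ⟨fun x y =>
  ⟨x.re * y.re - x.imI * y.imI + x.imI * y.imE + x.imE * y.imI + x.imH * y.imH,
   x.re * y.imI + x.imI * y.re + x.imI * y.imH - x.imH * y.imI,
   x.re * y.imE + x.imE * y.re + x.imI * y.imH - x.imH * y.imI
     + x.imH * y.imE - x.imE * y.imH,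
   x.re * y.imH + x.imH * y.re + x.imE * y.imI - x.imI * y.imE⟩⟩

instance {S : Type*} [SMul S R] : SMul S (Hybrid R) :=
  ⟨fun s x => ⟨s • x.re, s • x.imI, s • x.imE, s • x.imH⟩⟩

/-- The hybrid unit `𝐢`. -/
def iu : Hybrid R := ⟨0, 1, 0, 0⟩
/-- The hybrid unit `ε`. -/
def eu : Hybrid R := ⟨0, 0, 1, 0⟩
/-- The hybrid unit `𝐡`. -/
def hu : Hybrid R := ⟨0, 0, 0, 1⟩

end Hybrid

noncomputable section

open Quaternion

/-- Hybrid quaternions: hybrid numbers with quaternion coefficients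
(the quaternion units commute with the hybrid units). -/
abbrev HQ := Hybrid (ℍ[ℝ])

/-- The quaternion unit `i` in the hybrid quaternion algebra. -/
def qi : HQ := ⟨⟨0, 1, 0, 0⟩, 0, 0, 0⟩
/-- The quaternion unit `j` in the hybrid quaternion algebra. -/
def qj : HQ := ⟨⟨0, 0, 1, 0⟩, 0, 0, 0⟩
/-- The quaternion unit `k` in the hybrid quaternion algebra. -/
def qk : HQ := ⟨⟨0, 0, 0, 1⟩, 0, 0, 0⟩

/-- Embedding of the real quaternions into the hybrid quaternions. -/
def eQ (q : ℍ[ℝ]) : HQ := ⟨q, 0, 0, 0⟩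
/-- Embedding of the hybrid numbers into the hybrid quaternions. -/
def eH (z : Hybrid ℝ) : HQ :=
  ⟨⟨z.re, 0, 0, 0⟩, ⟨z.imI, 0, 0, 0⟩, ⟨z.imE, 0, 0, 0⟩, ⟨z.imH, 0, 0, 0⟩⟩

/-- Fibonacci numbers, as real numbers. -/
def F (n : ℕ) : ℝ := Nat.fib n

/-- Lucas numbers, as real numbers. -/
def lucas : ℕ → ℝ
  | 0 => 2
  | 1 => 1
  | n + 2 => lucas (n + 1) + lucas n

/-- The Fibonacci quaternion `F̃ₘ = Fₘ + i F_{m+1} + j F_{m+2} + k F_{m+3}`. -/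
def fq (m : ℕ) : ℍ[ℝ] := ⟨F m, F (m + 1), F (m + 2), F (m + 3)⟩
/-- The Lucas quaternion `L̃ₘ`. -/
def lq (m : ℕ) : ℍ[ℝ] := ⟨lucas m, lucas (m + 1), lucas (m + 2), lucas (m + 3)⟩
/-- The Fibonacci hybrid number `F̆ₘ = Fₘ + 𝐢 F_{m+1} + ε F_{m+2} + 𝐡 F_{m+3}`. -/
def fh (m : ℕ) : Hybrid ℝ := ⟨F m, F (m + 1), F (m + 2), F (m + 3)⟩
/-- The Lucas hybrid number `L̆ₘ`. -/
def lh (m : ℕ) : Hybrid ℝ := ⟨lucas m, lucas (m + 1), lucas (m + 2), lucas (m + 3)⟩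
/-- The Fibonacci hybrid quaternion
`F̂ₙ = F̃ₙ + 𝐢 F̃_{n+1} + ε F̃_{n+2} + 𝐡 F̃_{n+3}
    = F̆ₙ + i F̆_{n+1} + j F̆_{n+2} + k F̆_{n+3}`. -/
def Fhat (n : ℕ) : HQ := ⟨fq n, fq (n + 1), fq (n + 2), fq (n + 3)⟩
/-- The Lucas hybrid quaternion `L̂ₙ`. -/
def Lhat (n : ℕ) : HQ := ⟨lq n, lq (n + 1), lq (n + 2), lq (n + 3)⟩

/-- `α = (1 + √5)/2`. -/
def ga : ℝ := (1 + Real.sqrt 5) / 2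
/-- `β = (1 - √5)/2`. -/
def gb : ℝ := (1 - Real.sqrt 5) / 2

/-- `x* = 1 + 𝐢 x + ε x² + 𝐡 x³` (a hybrid number with real coefficients). -/
def hstar (x : ℝ) : HQ :=
  ⟨1, ⟨x, 0, 0, 0⟩, ⟨x ^ 2, 0, 0, 0⟩, ⟨x ^ 3, 0, 0, 0⟩⟩
/-- `x̲ = 1 + i x + j x² + k x³` (a quaternion with real coefficients). -/
def qund (x : ℝ) : HQ := eQ ⟨1, x, x ^ 2, x ^ 3⟩

/-- The Horadam quaternion `H̃ₘ = wₘ + i w_{m+1} + j w_{m+2} + k w_{m+3}`. -/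
def hquat (w : ℕ → ℝ) (m : ℕ) : ℍ[ℝ] := ⟨w m, w (m + 1), w (m + 2), w (m + 3)⟩

/-- The Horadam hybrid quaternion `Ĥₙ = H̃ₙ + 𝐢 H̃_{n+1} + ε H̃_{n+2} + 𝐡 H̃_{n+3}`. -/
def Hhat (w : ℕ → ℝ) (n : ℕ) : HQ :=
  ⟨hquat w n, hquat w (n + 1), hquat w (n + 2), hquat w (n + 3)⟩

/-- Binet formula for Horadam hybrid quaternions,
`Ĥₙ = A α* α̲ αⁿ + B β* β̲ βⁿ`. -/
theorem horadam_hybrid_quaternion_binet (p q w0 w1 α β : ℝ)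
    (hα : α ^ 2 - p * α + q = 0) (hβ : β ^ 2 - p * β + q = 0) (hne : α ≠ β)
    (w : ℕ → ℝ) (h0 : w 0 = w0) (h1 : w 1 = w1)
    (hrec : ∀ n : ℕ, w (n + 2) = p * w (n + 1) - q * w n) (n : ℕ) :
    Hhat w n =
      ((w1 - w0 * β) / (α - β) * α ^ n) • (hstar α * qund α) +
      ((w0 * α - w1) / (α - β) * β ^ n) • (hstar β * qund β) := by
  have hd : α - β ≠ 0 := sub_ne_zero.mpr hne
  have key : ∀ m : ℕ, w m = (w1 - w0 * β) / (α - β) * α ^ m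
      + (w0 * α - w1) / (α - β) * β ^ m := by
    intro m
    induction m using Nat.twoStepInduction with
    | zero => rw [h0]; field_simp; ring
    | one => rw [h1]; field_simp; ring
    | more m ih1 ih2 =>
      rw [hrec, ih1, ih2]
      linear_combination (-((w1 - w0 * β) / (α - β) * α ^ m)) * hα
        - ((w0 * α - w1) / (α - β) * β ^ m) * hβ
  generalize (w1 - w0 * β) / (α - β) = A at key ⊢
  generalize (w0 * α - w1) / (α - β) = B at key ⊢
  have hadd : ∀ x y : HQ, x + y =
      ⟨x.re + y.re, x.imI + y.imI, x.imE + y.imE, x.imH + y.imH⟩ := fun _ _ => rfl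
  have hsmul : ∀ (s : ℝ) (x : HQ), s • x =
      ⟨s • x.re, s • x.imI, s • x.imE, s • x.imH⟩ := fun _ _ => rfl
  have hmul : ∀ (x : HQ) (y : ℍ[ℝ]), x * eQ y =
      ⟨x.re * y, x.imI * y, x.imE * y, x.imH * y⟩ := by
    intro x y
    have h : x * eQ y =
      ⟨x.re * y - x.imI * 0 + x.imI * 0 + x.imE * 0 + x.imH * 0,
       x.re * 0 + x.imI * y + x.imI * 0 - x.imH * 0,
       x.re * 0 + x.imE * y + x.imI * 0 - x.imH * 0 + x.imH * 0 - x.imE * 0,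
       x.re * 0 + x.imH * y + x.imE * 0 - x.imI * 0⟩ := rfl
    rw [h]; simp
  have hq : ∀ x : ℝ, ∃ y : ℍ[ℝ], qund x = eQ y ∧ y.re = 1 ∧ y.imI = x ∧ y.imJ = x ^ 2
      ∧ y.imK = x ^ 3 := fun x => ⟨_, rfl, rfl, rfl, rfl, rfl⟩
  have hs : ∀ x : ℝ, hstar x =
      ⟨1, (x : ℍ[ℝ]), ((x ^ 2 : ℝ) : ℍ[ℝ]), ((x ^ 3 : ℝ) : ℍ[ℝ])⟩ := fun _ => rfl
  have e0 : ∀ m, (hquat w m).re = w m := fun _ => rfl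
  have e1 : ∀ m, (hquat w m).imI = w (m + 1) := fun _ => rfl
  have e2 : ∀ m, (hquat w m).imJ = w (m + 2) := fun _ => rfl
  have e3 : ∀ m, (hquat w m).imK = w (m + 3) := fun _ => rfl
  obtain ⟨a, ha, a0, a1, a2, a3⟩ := hq α
  obtain ⟨b, hb, b0, b1, b2, b3⟩ := hq β
  rw [ha, hb, hmul, hmul, hsmul, hsmul, hadd, hs, hs, Hhat]
  have comp : ∀ (m k : ℕ), hquat w (m + k) =
      (A * α ^ m) • (((α ^ k : ℝ) : ℍ[ℝ]) * a) + (B * β ^ m) • (((β ^ k : ℝ) : ℍ[ℝ]) * b) := by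
    intro m k
    rw [Quaternion.coe_mul_eq_smul, Quaternion.coe_mul_eq_smul]
    apply Quaternion.ext
    · simp only [Quaternion.re_add, Quaternion.re_smul, smul_eq_mul, e0, key, a0, b0]; ring
    · simp only [Quaternion.imI_add, Quaternion.imI_smul, smul_eq_mul, e1, key, a1, b1]; ring
    · simp only [Quaternion.imJ_add, Quaternion.imJ_smul, smul_eq_mul, e2, key, a2, b2]; ring
    · simp only [Quaternion.imK_add, Quaternion.imK_smul, smul_eq_mul, e3, key, a3, b3]; ring
  apply Hybrid.ext
  · simpa using comp n 0
  · simpa only [pow_one] using comp n 1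
  · exact comp n 2
  · exact comp n 3
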